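/- Let X have the free Poisson (Marchenko–Pastur) distribution with rate λ > 1 and jump size α > 0. Then X is invertible and the free cumulants of X^{-1} are R_k(X^{-1}) = C_{k-1} / (α^k (λ-1)^{2k-1}) for all k ≥ 1, where C_k denotes the k-th Catalan number. -/

import Mathlib

open scoped Classical
open Finset

noncomputable section

namespace FreeProbLukacs

variable {A : Type*}

/-- Ordered (non-commutative) product of a tuple. -/
def tprod [Monoid A] {n : ℕ} (X : Fin n → A) : A := (List.ofFn X).prod

/-- `P` is a partition of `Fin n`: a finset of nonempty blocks, each point in a unique block. -/
def IsPartition {n : ℕ} (P : Finset (Finset (Fin n))) : Prop :=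
  (∀ B ∈ P, B.Nonempty) ∧ ∀ i : Fin n, ∃! B, B ∈ P ∧ i ∈ B

/-- `P` is non-crossing: there are no `a < b < c < d` with `a, c` in one block and
`b, d` in a different block. -/
def IsNonCrossing {n : ℕ} (P : Finset (Finset (Fin n))) : Prop :=
  ∀ B₁ ∈ P, ∀ B₂ ∈ P, ∀ a ∈ B₁, ∀ b ∈ B₂, ∀ c ∈ B₁, ∀ d ∈ B₂,
    a < b → b < c → c < d → B₁ = B₂

/-- The finset of all non-crossing partitions of `Fin n`. -/
def NC (n : ℕ) : Finset (Finset (Finset (Fin n))) :=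
  univ.filter fun P => IsPartition P ∧ IsNonCrossing P

/-- The cumulant functional `R` applied to the entries of `X` lying in a block `B`,
taken in increasing order of position. -/
def blockCum (R : ∀ n, (Fin n → A) → ℂ) {n : ℕ} (X : Fin n → A) (B : Finset (Fin n)) : ℂ :=
  R B.card fun j => X ((B.sort (· ≤ ·)).get (Fin.cast (Finset.length_sort (· ≤ ·)).symm j))

/-- Product of block cumulants over the blocks of a partition. -/
def partCum (R : ∀ n, (Fin n → A) → ℂ) {n : ℕ} (X : Fin n → A)
    (P : Finset (Finset (Fin n))) : ℂ :=
  ∏ B ∈ P, blockCum R X B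

/-- The moment–cumulant formula: `R` is the family of free cumulants of `φ`. -/
def MomentCumulant [Monoid A] (φ : A → ℂ) (R : ∀ n, (Fin n → A) → ℂ) : Prop :=
  ∀ (n : ℕ) (X : Fin n → A), φ (tprod X) = ∑ P ∈ NC n, partCum R X P

/-- Density of the absolutely continuous part of the Marchenko–Pastur law. -/
def freePoissonDensity (l a x : ℝ) : ℝ :=
  Real.sqrt (4 * l * a ^ 2 - (x - a * (1 + l)) ^ 2) / (2 * Real.pi * a * x)

/-- The free Poisson (Marchenko–Pastur) distribution with rate `l` and jump size `a`. -/
def freePoissonMeasure (l a : ℝ) : MeasureTheory.Measure ℝ :=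
  ENNReal.ofReal (max 0 (1 - l)) • MeasureTheory.Measure.dirac 0 +
    MeasureTheory.volume.withDensity fun x => ENNReal.ofReal (freePoissonDensity l a x)

/-- `X` has distribution `μ` in the sense of moments. -/
def HasMoments [Monoid A] (φ : A → ℂ) (X : A) (μ : MeasureTheory.Measure ℝ) : Prop :=
  ∀ r : ℕ, φ (X ^ r) = ((∫ t, t ^ r ∂μ : ℝ) : ℂ)

/-- `φ` is a state: unital and positive. -/
def IsState [Ring A] [StarRing A] [Module ℂ A] (φ : A →ₗ[ℂ] ℂ) : Prop :=
  φ 1 = 1 ∧ ∀ a : A, ∃ r : ℝ, 0 ≤ r ∧ φ (star a * a) = (r : ℂ)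

/-- `φ` is faithful. -/
def Faithful [Ring A] [StarRing A] [Module ℂ A] (φ : A →ₗ[ℂ] ℂ) : Prop :=
  ∀ a : A, φ (star a * a) = 0 → a = 0

/-- `φ` is tracial. -/
def Tracial [Ring A] [Module ℂ A] (φ : A →ₗ[ℂ] ℂ) : Prop :=
  ∀ a b : A, φ (a * b) = φ (b * a)

/-- All mixed cumulants with entries from `S` and from `T` vanish. -/
def MixedVanish (R : ∀ n, (Fin n → A) → ℂ) (S T : Set A) : Prop :=
  ∀ (n : ℕ) (f : Fin n → A), (∀ i, f i ∈ S ∪ T) → (∃ i, f i ∈ S) → (∃ j, f j ∈ T) →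
    R n f = 0

/-- Two elements are free: all their mixed free cumulants vanish. -/
def FreeElems (R : ∀ n, (Fin n → A) → ℂ) (x y : A) : Prop :=
  MixedVanish R {x} {y}

/-- Interleaving of a partition `P` (placed at positions `1,2,…,n`, i.e. evens)
and `Q` (placed at positions `1̄,…,n̄`, i.e. odds) inside `Fin (2 * n)`. -/
def interleave {n : ℕ} (P Q : Finset (Finset (Fin n))) : Finset (Finset (Fin (2 * n))) :=
  P.image (fun B => B.image fun i => (⟨2 * i.1, by have := i.isLt; omega⟩ : Fin (2 * n)))
    ∪ Q.image (fun B => B.image fun i => (⟨2 * i.1 + 1, by have := i.isLt; omega⟩ : Fin (2 * n)))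

/-- `Q` refines ... : every block of `P` is contained in a block of `Q`. -/
def Refines {n : ℕ} (P Q : Finset (Finset (Fin n))) : Prop :=
  ∀ B ∈ P, ∃ C ∈ Q, B ⊆ C

/-- `Q` is the Kreweras complement of `P`: the largest partition whose interleaving
with `P` is non-crossing. -/
def IsKrewerasComplement {n : ℕ} (P Q : Finset (Finset (Fin n))) : Prop :=
  IsPartition Q ∧ IsNonCrossing (interleave P Q) ∧
    ∀ Q', IsPartition Q' → IsNonCrossing (interleave P Q') → Refines Q' Q

end FreeProbLukacs
namespace FreeProbLukacs

/-- The non-crossing partitions of a finite set of natural numbers. -/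
def ncOn (s : Finset ℕ) : Finset (Finset (Finset ℕ)) :=
  s.powerset.powerset.filter fun P =>
    (∀ B ∈ P, B.Nonempty) ∧ (∀ i ∈ s, ∃ B ∈ P, i ∈ B) ∧
      (∀ B ∈ P, ∀ C ∈ P, ∀ i, i ∈ B → i ∈ C → B = C) ∧
      ∀ B ∈ P, ∀ C ∈ P, ∀ a ∈ B, ∀ b ∈ C, ∀ c ∈ B, ∀ d ∈ C, a < b → b < c → c < d → B = C

theorem mem_ncOn {s : Finset ℕ} {P : Finset (Finset ℕ)} :
    P ∈ ncOn s ↔ (∀ B ∈ P, B ⊆ s) ∧ (∀ B ∈ P, B.Nonempty) ∧ (∀ i ∈ s, ∃ B ∈ P, i ∈ B) ∧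
      (∀ B ∈ P, ∀ C ∈ P, ∀ i, i ∈ B → i ∈ C → B = C) ∧
      ∀ B ∈ P, ∀ C ∈ P, ∀ a ∈ B, ∀ b ∈ C, ∀ c ∈ B, ∀ d ∈ C,
        a < b → b < c → c < d → B = C := by
  simp only [ncOn, mem_filter, mem_powerset, subset_iff]

/-- The sum over non-crossing partitions of `s` of the products of `r` over block sizes. -/
def ncWeight (r : ℕ → ℂ) (s : Finset ℕ) : ℂ := ∑ P ∈ ncOn s, ∏ B ∈ P, r #B

/-- The part of `ncWeight r s` coming from partitions with a block containing `T`. -/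
def ncWeightAbove (r : ℕ → ℂ) (T s : Finset ℕ) : ℂ :=
  ∑ P ∈ ncOn s with ∃ B ∈ P, T ⊆ B, ∏ B ∈ P, r #B

theorem mem_NC {n : ℕ} {P : Finset (Finset (Fin n))} :
    P ∈ NC n ↔ IsPartition P ∧ IsNonCrossing P := by
  rw [NC, mem_filter, and_iff_right (mem_univ P)]

theorem sum_NC_eq_ncWeight (r : ℕ → ℂ) (n c : ℕ) :
    ∑ P ∈ NC n, ∏ B ∈ P, r #B = ncWeight r (Ico c (c + n)) := by
  let e : Fin n → ℕ := fun i => c + i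
  have he : Function.Injective e := fun i j h => Fin.ext (by simpa [e] using h)
  have hlt : ∀ i j, e i < e j ↔ i < j := fun i j => by simp [e]
  have hsurj : ∀ x ∈ Ico c (c + n), ∃ i, e i = x := fun x hx => by
    rw [mem_Ico] at hx
    exact ⟨⟨x - c, by omega⟩, by simp only [e]; omega⟩
  refine Finset.sum_bij (fun P _ => P.image (fun B => B.image e)) ?_ ?_ ?_ ?_
  · intro P hP
    obtain ⟨⟨hne, hu⟩, hnc⟩ := mem_NC.1 hP
    rw [mem_ncOn]
    simp only [forall_mem_image, exists_mem_image]
    refine ⟨?_, ?_, ?_, ?_, ?_⟩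
    · intro B hB x hx
      obtain ⟨i, -, rfl⟩ := mem_image.1 hx
      simp [e]
    · exact fun B hB => (hne B hB).image e
    · intro x hx
      obtain ⟨i, rfl⟩ := hsurj x hx
      obtain ⟨B, ⟨hB, hi⟩, -⟩ := hu i
      exact ⟨B, hB, mem_image_of_mem e hi⟩
    · intro B hB C hC i hi hxC
      rw [he.mem_finset_image] at hxC
      rw [(hu i).unique ⟨hB, hi⟩ ⟨hC, hxC⟩]
    · intro B hB C hC i hi j hj k hk m hm
      rw [hlt, hlt, hlt]
      intro h1 h2 h3
      rw [hnc B hB C hC i hi j hj k hk m hm h1 h2 h3]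
  · intro P _ Q _ h
    exact image_injective (image_injective he) h
  · intro Q hQ
    obtain ⟨hsub, hne, hcov, huniq, hnc⟩ := mem_ncOn.1 hQ
    have hpre : ∀ B ∈ Q, ∃ B' : Finset (Fin n), B'.image e = B := fun B hB =>
      ⟨univ.filter fun i => e i ∈ B, by
        ext x
        simp only [mem_image, mem_filter, mem_univ, true_and]
        constructor
        · rintro ⟨i, hi, rfl⟩
          exact hi
        · intro hx
          obtain ⟨i, rfl⟩ := hsurj x (hsub B hB hx)
          exact ⟨i, hx, rfl⟩⟩
    refine ⟨univ.filter fun B => B.image e ∈ Q, ?_, ?_⟩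
    · refine mem_NC.2 ⟨⟨?_, ?_⟩, ?_⟩
      · exact fun B hB => image_nonempty.1 (hne _ (mem_filter.1 hB).2)
      · intro i
        obtain ⟨B, hB, hi⟩ := hcov (e i) (by simp [e])
        obtain ⟨B, rfl⟩ := hpre B hB
        rw [he.mem_finset_image] at hi
        refine ⟨B, ⟨mem_filter.2 ⟨mem_univ _, hB⟩, hi⟩, ?_⟩
        rintro C ⟨hC, hiC⟩
        exact image_injective he
          (huniq _ (mem_filter.1 hC).2 _ hB (e i) (mem_image_of_mem e hiC) (mem_image_of_mem e hi))
      · intro B hB C hC i hi j hj k hk m hm h1 h2 h3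
        exact image_injective he (hnc _ (mem_filter.1 hB).2 _ (mem_filter.1 hC).2
          _ (mem_image_of_mem e hi) _ (mem_image_of_mem e hj) _ (mem_image_of_mem e hk) _ (mem_image_of_mem e hm)
          ((hlt _ _).2 h1) ((hlt _ _).2 h2) ((hlt _ _).2 h3))
    · ext B
      simp only [mem_image, mem_filter, mem_univ, true_and]
      constructor
      · rintro ⟨B, hB, rfl⟩
        exact hB
      · intro hB
        obtain ⟨B, rfl⟩ := hpre B hB
        exact ⟨B, hB, rfl⟩
  · intro P _
    rw [prod_image (image_injective he).injOn]
    exact prod_congr rfl fun B _ => by rw [card_image_of_injective _ he]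

theorem sum_ncOn_split (r : ℕ → ℂ) {s₁ s₂ T : Finset ℕ} (hd : Disjoint s₁ s₂)
    (hc : ∀ a ∈ s₁, ∀ b ∈ s₂, ∀ c ∈ s₁, a < b → ¬ b < c) (hT : T.Nonempty) (hTs : T ⊆ s₂) :
    ∑ P ∈ ncOn (s₁ ∪ s₂) with (∀ B ∈ P, B ⊆ s₁ ∨ B ⊆ s₂) ∧ ∃ B ∈ P, T ⊆ B, ∏ B ∈ P, r #B =
      ncWeight r s₁ * ncWeightAbove r T s₂ := by
  have hdis : ∀ {i}, i ∈ s₁ → i ∈ s₂ → False := fun h1 h2 => disjoint_left.1 hd h1 h2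
  have hnot : ∀ {B : Finset ℕ}, B.Nonempty → B ⊆ s₁ → B ⊆ s₂ → False :=
    fun ⟨i, hi⟩ h1 h2 => hdis (h1 hi) (h2 hi)
  rw [ncWeight, ncWeightAbove, sum_mul_sum, ← sum_product']
  symm
  refine Finset.sum_nbij' (fun p => p.1 ∪ p.2)
    (fun P => (P.filter (· ⊆ s₁), P.filter (· ⊆ s₂))) ?_ ?_ ?_ ?_ ?_
  · rintro ⟨P, Q⟩ hPQ
    simp only [mem_product, mem_filter, mem_ncOn] at hPQ
    obtain ⟨⟨hs, hn, hcv, hu, hx⟩, ⟨hs', hn', hcv', hu', hx'⟩, D, hD, hTD⟩ := hPQ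
    simp only [mem_filter, mem_ncOn]
    refine ⟨⟨?_, ?_, ?_, ?_, ?_⟩, ?_, D, mem_union_right _ hD, hTD⟩
    · intro B hB
      rcases mem_union.1 hB with h | h
      · exact (hs B h).trans subset_union_left
      · exact (hs' B h).trans subset_union_right
    · intro B hB
      rcases mem_union.1 hB with h | h
      · exact hn B h
      · exact hn' B h
    · intro i hi
      rcases mem_union.1 hi with h | h
      · obtain ⟨B, hB, hiB⟩ := hcv i h
        exact ⟨B, mem_union_left _ hB, hiB⟩
      · obtain ⟨B, hB, hiB⟩ := hcv' i h
        exact ⟨B, mem_union_right _ hB, hiB⟩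
    · intro B hB C hC i hi hi'
      rcases mem_union.1 hB with h | h <;> rcases mem_union.1 hC with h' | h'
      · exact hu B h C h' i hi hi'
      · exact (hdis (hs B h hi) (hs' C h' hi')).elim
      · exact (hdis (hs C h' hi') (hs' B h hi)).elim
      · exact hu' B h C h' i hi hi'
    · intro B hB C hC a ha b hb c hc' d hd' h1 h2 h3
      rcases mem_union.1 hB with h | h <;> rcases mem_union.1 hC with h' | h'
      · exact hx B h C h' a ha b hb c hc' d hd' h1 h2 h3
      · exact (hc a (hs B h ha) b (hs' C h' hb) c (hs B h hc') h1 h2).elim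
      · exact (hc b (hs C h' hb) c (hs' B h hc') d (hs C h' hd') h2 h3).elim
      · exact hx' B h C h' a ha b hb c hc' d hd' h1 h2 h3
    · intro B hB
      rcases mem_union.1 hB with h | h
      · exact Or.inl (hs B h)
      · exact Or.inr (hs' B h)
  · intro P hP
    simp only [mem_filter, mem_ncOn] at hP
    obtain ⟨⟨hs, hn, hcv, hu, hx⟩, hsp, D, hD, hTD⟩ := hP
    simp only [mem_product, mem_filter, mem_ncOn]
    refine ⟨⟨fun B hB => hB.2, fun B hB => hn B hB.1, ?_,
      fun B hB C hC => hu B hB.1 C hC.1, fun B hB C hC => hx B hB.1 C hC.1⟩,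
      ⟨fun B hB => hB.2, fun B hB => hn B hB.1, ?_,
      fun B hB C hC => hu B hB.1 C hC.1, fun B hB C hC => hx B hB.1 C hC.1⟩, D, ⟨hD, ?_⟩, hTD⟩
    · intro i hi
      obtain ⟨B, hB, hiB⟩ := hcv i (mem_union_left _ hi)
      exact ⟨B, ⟨hB, (hsp B hB).resolve_right fun h => hdis hi (h hiB)⟩, hiB⟩
    · intro i hi
      obtain ⟨B, hB, hiB⟩ := hcv i (mem_union_right _ hi)
      exact ⟨B, ⟨hB, (hsp B hB).resolve_left fun h => hdis (h hiB) hi⟩, hiB⟩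
    · obtain ⟨t, ht⟩ := hT
      exact (hsp D hD).resolve_left fun h => hdis (h (hTD ht)) (hTs ht)
  · rintro ⟨P, Q⟩ hPQ
    simp only [mem_product, mem_filter, mem_ncOn] at hPQ
    obtain ⟨⟨hs, hn, -⟩, ⟨hs', hn', -⟩, -⟩ := hPQ
    simp only [Prod.mk.injEq]
    constructor
    · ext B
      simp only [mem_filter, mem_union]
      exact ⟨fun ⟨h, h1⟩ => h.resolve_right fun h' => hnot (hn' B h') h1 (hs' B h'),
        fun h => ⟨Or.inl h, hs B h⟩⟩
    · ext B
      simp only [mem_filter, mem_union]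
      exact ⟨fun ⟨h, h1⟩ => h.resolve_left fun h' => hnot (hn B h') (hs B h') h1,
        fun h => ⟨Or.inr h, hs' B h⟩⟩
  · intro P hP
    simp only [mem_filter] at hP
    ext B
    simp only [mem_filter, mem_union]
    exact ⟨fun h => h.elim And.left And.left, fun h => (hP.2.1 B h).imp (⟨h, ·⟩) (⟨h, ·⟩)⟩
  · rintro ⟨P, Q⟩ hPQ
    simp only [mem_product, mem_filter, mem_ncOn] at hPQ
    obtain ⟨⟨hs, hn, -⟩, ⟨hs', -⟩, -⟩ := hPQ
    rw [prod_union (disjoint_left.2 fun B h h' => hnot (hn B h) (hs B h) (hs' B h'))]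

theorem ncWeightAbove_self (r : ℕ → ℂ) {T : Finset ℕ} (hT : T.Nonempty) :
    ncWeightAbove r T T = r #T := by
  have : (ncOn T).filter (fun P => ∃ B ∈ P, T ⊆ B) = {{T}} := by
    ext P
    simp only [mem_filter, mem_ncOn, mem_singleton]
    constructor
    · rintro ⟨⟨hs, hn, -, hu, -⟩, D, hD, hTD⟩
      obtain rfl : D = T := (hs D hD).antisymm hTD
      refine eq_singleton_iff_unique_mem.2 ⟨hD, fun B hB => ?_⟩
      obtain ⟨i, hi⟩ := hn B hB
      exact hu B hB D hD i hi (hs B hB hi)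
    · rintro rfl
      simp only [mem_singleton, forall_eq, exists_eq_left]
      exact ⟨⟨Subset.rfl, hT, fun i hi => hi, fun _ _ _ => trivial, fun _ _ _ _ _ _ _ _ _ _ _ => trivial⟩, Subset.rfl⟩
  rw [ncWeightAbove, this, sum_singleton, prod_singleton]

/-- Recursion on the smallest element of the block of `T` that lies beyond `T`. -/
theorem ncWeightAbove_union_Ico (r : ℕ → ℂ) {T : Finset ℕ} (hT : T.Nonempty) {c d : ℕ}
    (hTc : ∀ t ∈ T, t < c) :
    ncWeightAbove r T (T ∪ Ico c d) = ncWeight r (Ico c d) * r #T +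
      ∑ y ∈ Ico c d, ncWeight r (Ico c y) *
        ncWeightAbove r (insert y T) (insert y T ∪ Ico (y + 1) d) := by
  let K : Finset (Finset ℕ) → Finset ℕ := fun P =>
    insert d ((Ico c d).filter fun u => ∃ B ∈ P, T ⊆ B ∧ u ∈ B)
  have hK : ∀ P, (K P).Nonempty := fun P => insert_nonempty _ _
  let f : Finset (Finset ℕ) → ℕ := fun P => (K P).min' (hK P)
  have hmem : ∀ P, f P = d ∨ f P ∈ Ico c d ∧ ∃ B ∈ P, T ⊆ B ∧ f P ∈ B := fun P =>
    (mem_insert.1 ((K P).min'_mem (hK P))).imp_right mem_filter.1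
  have hle : ∀ P, f P ≤ d := fun P => min'_le _ _ (mem_insert_self _ _)
  have hlow : ∀ P, ∀ B ∈ P, T ⊆ B → ∀ u ∈ B, u ∈ Ico c d → f P ≤ u := fun P B hB hTB u hu huc =>
    min'_le _ _ (mem_insert_of_mem (mem_filter.2 ⟨huc, B, hB, hTB, hu⟩))
  obtain ⟨t, ht⟩ := id hT
  have htc := hTc t ht
  have hmaps : ∀ P ∈ (ncOn (T ∪ Ico c d)).filter (fun P => ∃ B ∈ P, T ⊆ B),
      f P ∈ insert d (Ico c d) := fun P _ =>
    (hmem P).elim (fun h => h ▸ mem_insert_self _ _) fun h => mem_insert_of_mem h.1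
  rw [ncWeightAbove, ← sum_fiberwise_of_maps_to hmaps, sum_insert (by simp)]
  congr 1
  · rw [← ncWeightAbove_self r hT, ← sum_ncOn_split r (disjoint_left.2 fun x hx hxT => by
      have := hTc x hxT; rw [mem_Ico] at hx; omega) (fun a ha b hb c' _ h => by
      have := hTc b hb; rw [mem_Ico] at ha; omega) hT Subset.rfl, union_comm, filter_filter]
    refine sum_congr (filter_congr fun P hP => ?_) fun _ _ => rfl
    obtain ⟨hs, hn, hcv, hu, hx⟩ := mem_ncOn.1 hP
    constructor
    · rintro ⟨⟨D, hD, hTD⟩, hf⟩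
      refine ⟨fun B hB => ?_, D, hD, hTD⟩
      by_cases hBD : B = D
      · subst hBD
        refine Or.inr fun u hu' => (mem_union.1 (hs B hB hu')).resolve_left fun h => ?_
        have := hlow P B hD hTD u hu' h
        rw [mem_Ico] at h
        omega
      · refine Or.inl fun u hu' => (mem_union.1 (hs B hB hu')).resolve_right fun h => ?_
        exact hBD (hu B hB D hD u hu' (hTD h))
    · rintro ⟨hsp, D, hD, hTD⟩
      refine ⟨⟨D, hD, hTD⟩, (hmem P).resolve_right ?_⟩
      rintro ⟨hfc, B, hB, hTB, hfB⟩
      rcases hsp B hB with h | h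
      · have := mem_Ico.1 (h (hTB ht))
        omega
      · have := hTc _ (h hfB)
        rw [mem_Ico] at hfc
        omega
  · refine sum_congr rfl fun y hy => ?_
    have hy' := mem_Ico.1 hy
    rw [← sum_ncOn_split r (disjoint_left.2 fun x hx hx' => by
        simp only [mem_union, mem_insert, mem_Ico] at hx hx'
        rcases hx' with (h | h) | h
        · omega
        · have := hTc x h; omega
        · omega) (fun a ha b hb c' hc' h => by
        simp only [mem_union, mem_insert, mem_Ico] at ha hb hc'
        rcases hb with (h | h) | h
        · omega
        · have := hTc b h; omega
        · omega) (insert_nonempty _ _) subset_union_left, filter_filter]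
    have hset : Ico c y ∪ (insert y T ∪ Ico (y + 1) d) = T ∪ Ico c d := by
      ext x
      simp only [mem_union, mem_insert, mem_Ico]
      by_cases hxT : x ∈ T
      · simp [hxT]
      · simp only [hxT, false_or, or_false]; omega
    rw [hset]
    refine sum_congr (filter_congr fun P hP => ?_) fun _ _ => rfl
    obtain ⟨hs, hn, hcv, hu, hx⟩ := mem_ncOn.1 hP
    constructor
    · rintro ⟨⟨D, hD, hTD⟩, hf⟩
      have hyD : y ∈ D := by
        rcases hmem P with h | ⟨-, B, hB, hTB, hfB⟩
        · omega
        · rw [← hf, ← hu B hB D hD t (hTB ht) (hTD ht)]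
          exact hfB
      refine ⟨fun B hB => ?_, D, hD, insert_subset hyD hTD⟩
      by_cases hBD : B = D
      · subst hBD
        refine Or.inr fun u hu' => ?_
        have h1 := hs B hB hu'
        have h2 := hlow P B hD hTD u hu'
        simp only [mem_union, mem_insert, mem_Ico] at h1 h2 ⊢
        by_cases hxT : u ∈ T
        · simp [hxT]
        · simp only [hxT, false_or, or_false] at h1 ⊢; omega
      · by_cases hex : ∃ u ∈ B, u ∈ Ico c y
        · obtain ⟨u, huB, huc⟩ := hex
          left
          intro v hv
          by_contra hvc
          have hvs := hs B hB hv
          have hvT : v ∉ T := fun h => hBD (hu B hB D hD v hv (hTD h))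
          have hvy : v ≠ y := fun h => hBD (hu B hB D hD v hv (h ▸ hyD))
          simp only [mem_union, mem_Ico, hvT, false_or] at hvs hvc huc
          exact hBD (hx D hD B hB t (hTD ht) u huB y hyD v hv
            (by omega) (by omega) (by omega)).symm
        · push Not at hex
          refine Or.inr fun u hu' => ?_
          have h1 := hs B hB hu'
          have h2 := hex u hu'
          simp only [mem_union, mem_insert, mem_Ico] at h1 h2 ⊢
          by_cases hxT : u ∈ T
          · simp [hxT]
          · simp only [hxT, false_or, or_false] at h1 ⊢; omega
    · rintro ⟨hsp, D, hD, hTD⟩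
      have hyD : y ∈ D := hTD (mem_insert_self _ _)
      have hTD' : T ⊆ D := (subset_insert _ _).trans hTD
      refine ⟨⟨D, hD, hTD'⟩, le_antisymm (hlow P D hD hTD' y hyD hy) ?_⟩
      rcases hmem P with h | ⟨hfc, B, hB, hTB, hfB⟩
      · omega
      · rw [hu B hB D hD t (hTB ht) (hTD' ht)] at hfB
        rcases hsp D hD with h | h
        · have := mem_Ico.1 (h (hTD' ht))
          omega
        · have := h hfB
          simp only [mem_union, mem_insert, mem_Ico] at this hfc
          rcases this with (h | h) | h
          · omega
          · have := hTc _ h; omega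
          · omega

theorem ncWeight_Ico_succ (r : ℕ → ℂ) (n : ℕ) :
    ncWeight r (Ico 0 (n + 1)) = ncWeightAbove r {0} ({0} ∪ Ico 1 (1 + n)) := by
  have hset : ({0} ∪ Ico 1 (1 + n) : Finset ℕ) = Ico 0 (n + 1) := by
    ext x
    simp only [mem_union, mem_singleton, mem_Ico]
    omega
  rw [hset, ncWeight, ncWeightAbove, filter_true_of_mem]
  intro P hP
  obtain ⟨B, hB, h0⟩ := (mem_ncOn.1 hP).2.2.1 0 (by simp)
  exact ⟨B, hB, singleton_subset_iff.2 h0⟩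

open PowerSeries in
theorem subst_mk_eq_C_add_mul (r : ℕ → ℂ) {g : ℂ⟦X⟧} (hg : HasSubst g) (j : ℕ) :
    (PowerSeries.mk fun i => r (j + i)).subst g =
      C (r j) + g * (PowerSeries.mk fun i => r (j + 1 + i)).subst g := by
  have h : (PowerSeries.mk fun i => r (j + i)) = C (r j) + X * PowerSeries.mk fun i => r (j + 1 + i) := by
    ext n
    cases n with
    | zero => simp
    | succ n => simp [coeff_succ_X_mul, add_assoc, add_comm 1 n]
  rw [h, subst_add hg, subst_mul hg, subst_X hg, subst_C]
  rfl

open PowerSeries in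
theorem ncWeightAbove_eq_coeff {r m : ℕ → ℂ}
    (hm : ∀ n, m n = ∑ P ∈ NC n, ∏ B ∈ P, r #B) (n : ℕ) :
    ∀ (T : Finset ℕ), T.Nonempty → ∀ c, (∀ t ∈ T, t < c) →
      ncWeightAbove r T (T ∪ Ico c (c + n)) =
        coeff n (PowerSeries.mk m * (PowerSeries.mk fun i => r (#T + i)).subst (X * PowerSeries.mk m)) := by
  induction n using Nat.strong_induction_on with
  | _ n ih =>
    intro T hT c hc
    have hg : HasSubst (X * PowerSeries.mk m : ℂ⟦X⟧) := HasSubst.of_constantCoeff_zero' (by simp)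
    have hTy : ∀ y ∈ Ico c (c + n), y ∉ T := fun y hy h => by
      have := hc y h
      rw [mem_Ico] at hy
      omega
    rw [ncWeightAbove_union_Ico r hT hc, subst_mk_eq_C_add_mul r hg,
      ← sum_NC_eq_ncWeight, ← hm, mul_add, map_add, mul_comm (PowerSeries.mk m) (C _), coeff_C_mul,
      coeff_mk, mul_comm (m n)]
    congr 1
    cases n with
    | zero => simp
    | succ k =>
      rw [show ∀ S : ℂ⟦X⟧, PowerSeries.mk m * (X * PowerSeries.mk m * S) = X * (PowerSeries.mk m * (PowerSeries.mk m * S)) by intro S; ring,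
        coeff_succ_X_mul, coeff_mul, Finset.Nat.sum_antidiagonal_eq_sum_range_succ_mk,
        sum_Ico_eq_sum_range, add_tsub_cancel_left]
      refine sum_congr rfl fun i hi => ?_
      rw [mem_range] at hi
      have hmem : c + i ∈ Ico c (c + (k + 1)) := by rw [mem_Ico]; omega
      rw [coeff_mk, ← sum_NC_eq_ncWeight, ← hm,
        show c + (k + 1) = (c + i + 1) + (k - i) by omega,
        ih (k - i) (by omega) (insert (c + i) T) (insert_nonempty _ _) (c + i + 1),
        card_insert_of_notMem (hTy _ hmem)]
      intro t ht
      rcases mem_insert.1 ht with h | h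
      · omega
      · have := hc t h; omega

open PowerSeries in
/-- The functional equation between the moment series and the cumulant series. -/
theorem momentSeries_eq_one_add {r m : ℕ → ℂ}
    (hm : ∀ n, m n = ∑ P ∈ NC n, ∏ B ∈ P, r #B) :
    PowerSeries.mk m = 1 + X * PowerSeries.mk m * (PowerSeries.mk fun i => r (i + 1)).subst (X * PowerSeries.mk m) := by
  ext n
  rw [mul_assoc, map_add, coeff_mk]
  cases n with
  | zero =>
    have : NC 0 = {∅} := by
      ext P
      rw [mem_NC, mem_singleton]
      refine ⟨fun h => eq_empty_of_forall_notMem fun B hB => ?_, ?_⟩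
      · obtain ⟨i, -⟩ := h.1.1 B hB
        exact i.elim0
      · rintro rfl
        exact ⟨⟨by simp, fun i => i.elim0⟩, by simp [IsNonCrossing]⟩
    simp [hm, this]
  | succ n =>
    rw [hm, sum_NC_eq_ncWeight r (n + 1) 0, zero_add, ncWeight_Ico_succ,
      ncWeightAbove_eq_coeff hm n {0} (singleton_nonempty 0) 1 (by simp), card_singleton,
      coeff_succ_X_mul, coeff_one, if_neg (by omega), zero_add]
    simp only [add_comm]

open PowerSeries in
theorem subst_injective_of_ne_zero {g : ℂ⟦X⟧} (hg : HasSubst g) (hg0 : g ≠ 0)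
    (hgc : constantCoeff g = 0) :
    Function.Injective fun f : ℂ⟦X⟧ => f.subst g := by
  have key : ∀ f : ℂ⟦X⟧, f.subst g = 0 → f = 0 := by
    intro f hf
    have hzero : ∀ j, (PowerSeries.mk fun i => coeff (j + i) f).subst g = 0 →
        coeff j f = 0 ∧ (PowerSeries.mk fun i => coeff (j + 1 + i) f).subst g = 0 := by
      intro j hj
      rw [subst_mk_eq_C_add_mul (fun i => coeff i f) hg] at hj
      have h0 : coeff j f = 0 := by
        simpa [hgc] using congrArg (constantCoeff (R := ℂ)) hj
      rw [h0, map_zero, zero_add] at hj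
      exact ⟨h0, (mul_eq_zero.1 hj).resolve_left hg0⟩
    have hall : ∀ j, (PowerSeries.mk fun i => coeff (j + i) f).subst g = 0 := by
      intro j
      induction j with
      | zero =>
        rw [← hf]
        congr 1
        ext n
        simp
      | succ j ih => exact (hzero j ih).2
    ext j
    simpa using (hzero j (hall j)).1
  intro f f' h
  refine sub_eq_zero.1 (key _ ?_)
  rw [subst_sub hg]
  exact sub_eq_zero.2 h

open PowerSeries in
/-- A three-term linear recurrence forces a quadratic functional equation. -/
theorem quadratic_of_recurrence {m : ℕ → ℂ} {l a : ℂ} (ha : a ≠ 0) (hl : l - 1 ≠ 0)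
    (h0 : m 0 = 1) (h1 : a * (l - 1) * m 1 = 1)
    (hrec : ∀ k : ℕ, (k + 2) * (a ^ 2 * (l - 1) ^ 2) * m (k + 2)
      - (2 * k + 1) * (a * (1 + l)) * m (k + 1) + (k - 1) * m k = 0) :
    C (a * (l - 1)) * (PowerSeries.mk m - 1) =
      X * PowerSeries.mk m + C a * (PowerSeries.mk m - 1) ^ 2 := by
  set M : ℂ⟦X⟧ := PowerSeries.mk m with hM
  let u : ℂ⟦X⟧ := C (2 * a) * (M - 1) - C (a * (l - 1)) + X
  let D : ℂ⟦X⟧ := C (a ^ 2 * (l - 1) ^ 2) - C (2 * (a * (1 + l))) * X + X ^ 2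
  have hdu : d⁄dX ℂ u = C (2 * a) * d⁄dX ℂ M + 1 := by
    simp [u, Derivation.leibniz]
  have hdD : d⁄dX ℂ D = C (-2 * (a * (1 + l))) + C 2 * X := by
    simp [D, Derivation.leibniz]
    rw [map_ofNat]
  have hode : C 2 * D * d⁄dX ℂ u = d⁄dX ℂ D * u := by
    have e1 : C 2 * D * d⁄dX ℂ u = C (2 * (a ^ 2 * (l - 1) ^ 2)) * d⁄dX ℂ u
        - C (4 * (a * (1 + l))) * (X * d⁄dX ℂ u) + C 2 * (X * (X * d⁄dX ℂ u)) := by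
      simp only [D, map_mul, map_pow, map_ofNat]
      ring
    have e2 : d⁄dX ℂ D * u = C (-2 * (a * (1 + l))) * u + C 2 * (X * u) := by
      rw [hdD]
      ring
    rw [e1, e2]
    have hu0 : coeff 0 u = - (a * (l - 1)) := by simp [u, hM, h0]
    have hu1 : coeff 1 u = 2 * a * m 1 + 1 := by
      simp [u, hM, coeff_one, coeff_X, mul_assoc]
    have hu2 : ∀ n, coeff (n + 2) u = 2 * a * m (n + 2) := fun n => by
      simp only [u, hM, map_add, map_sub, coeff_C_mul, coeff_mk, coeff_one, coeff_C, coeff_X]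
      simp
    have hd0 : coeff 0 (d⁄dX ℂ u) = 2 * a * m 1 + 1 := by
      rw [coeff_derivative, zero_add, hu1]
      simp
    have hd : ∀ n, coeff (n + 1) (d⁄dX ℂ u) = 2 * a * m (n + 2) * (n + 2) := fun n => by
      rw [coeff_derivative, hu2]
      push_cast
      ring
    have hX0 : ∀ f : ℂ⟦X⟧, coeff 0 (X * f) = 0 := coeff_zero_X_mul
    have hX : ∀ n, ∀ f : ℂ⟦X⟧, coeff (n + 1) (X * f) = coeff n f := coeff_succ_X_mul
    ext n
    rcases n with _ | _ | _ | n
    · simp only [map_add, map_sub, coeff_C_mul, hX0, hd0, hu0]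
      linear_combination (4 * a ^ 2 * (l - 1)) * h1
    · have := hrec 0
      simp only [map_add, map_sub, coeff_C_mul, hX, hX0, hd, hd0, hu0, zero_add, hu1]
      push_cast at this ⊢
      linear_combination 4 * a * this + 4 * a * h0
    · have := hrec 1
      simp only [map_add, map_sub, coeff_C_mul, hX, hd, hd0, hu2, hu1, zero_add]
      push_cast at this ⊢
      linear_combination 4 * a * this
    · have := hrec (n + 2)
      simp only [map_add, map_sub, coeff_C_mul, hX, hd, hu2]
      push_cast at this ⊢
      linear_combination 4 * a * this
  have hD0 : constantCoeff D ≠ 0 := by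
    simp [D, ha, hl]
  have hDinv : D * D⁻¹ = 1 := PowerSeries.mul_inv_cancel D hD0
  have huD : u ^ 2 = D := by
    have : u ^ 2 * D⁻¹ = 1 := by
      apply derivative.ext
      · rw [Derivation.leibniz, derivative_inv', derivative_pow, derivative_one]
        simp only [smul_eq_mul]
        have h2 : C (2 : ℂ) = (2 : ℂ⟦X⟧) := map_ofNat _ 2
        rw [h2] at hode
        push_cast
        linear_combination (D⁻¹ ^ 2 * u) * hode + (-2 * u * d⁄dX ℂ u * D⁻¹) * hDinv
      · simp [u, D, hM, h0]
        field_simp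
    linear_combination D * this - u ^ 2 * hDinv
  have h4 : C (4 * a) * (C (a * (l - 1)) * (M - 1) - (X * M + C a * (M - 1) ^ 2)) = 0 := by
    have h2 : C (2 : ℂ) = (2 : ℂ⟦X⟧) := map_ofNat _ 2
    have h4 : C (4 : ℂ) = (4 : ℂ⟦X⟧) := map_ofNat _ 4
    simp only [u, D, map_mul, map_pow, map_sub, map_add, map_one, h2, h4] at huD ⊢
    linear_combination -huD
  refine sub_eq_zero.1 ((mul_eq_zero.1 h4).resolve_left fun h => ?_)
  have := congrArg (constantCoeff (R := ℂ)) h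
  simp [ha] at this

open PowerSeries in
theorem catalan_cumulants {r m : ℕ → ℂ} {l a : ℂ} (ha : a ≠ 0) (hl : l - 1 ≠ 0)
    (hm : ∀ n, m n = ∑ P ∈ NC n, ∏ B ∈ P, r #B) (h0 : m 0 = 1)
    (hquad : C (a * (l - 1)) * (PowerSeries.mk m - 1) =
      X * PowerSeries.mk m + C a * (PowerSeries.mk m - 1) ^ 2) (k : ℕ) :
    r (k + 1) = catalan k / (a ^ (k + 1) * (l - 1) ^ (2 * k + 1)) := by
  set M : ℂ⟦X⟧ := PowerSeries.mk m with hM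
  have hgc : constantCoeff (X * M) = 0 := by simp
  have hg : HasSubst (X * M) := HasSubst.of_constantCoeff_zero' hgc
  have hM0 : M ≠ 0 := fun h => by simpa [hM, h0] using congrArg (constantCoeff (R := ℂ)) h
  have hg0 : X * M ≠ 0 := mul_ne_zero X_ne_zero hM0
  let K : ℂ⟦X⟧ := PowerSeries.mk fun k => catalan k / (a ^ (k + 1) * (l - 1) ^ (2 * k + 1))
  have hK : C (a * (l - 1)) * K = 1 + C a * X * K ^ 2 := by
    ext n
    cases n with
    | zero =>
      simp [K]
      field_simp
    | succ n =>
      rw [show C a * X * K ^ 2 = C a * (X * (K * K)) by ring, map_add, coeff_C_mul, coeff_C_mul,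
        coeff_succ_X_mul, coeff_mul, coeff_one, if_neg (by omega), zero_add, coeff_mk,
        catalan_succ', Nat.cast_sum, sum_div, mul_sum, mul_sum]
      refine sum_congr rfl fun p hp => ?_
      rw [coeff_mk, coeff_mk]
      obtain rfl := mem_antidiagonal.1 hp
      push_cast
      field_simp
      ring
  have hW := momentSeries_eq_one_add hm
  rw [← hM] at hW
  set W : ℂ⟦X⟧ := K.subst (X * M) with hWdef
  have hWq : C (a * (l - 1)) * W = 1 + C a * (X * M) * W ^ 2 := by
    have h1 : (1 : ℂ⟦X⟧).subst (X * M) = 1 := by rw [← coe_substAlgHom hg, map_one]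
    have hC : ∀ c : ℂ, (C c : ℂ⟦X⟧).subst (X * M) = C c := fun c => subst_C c
    have := congrArg (fun f : ℂ⟦X⟧ => f.subst (X * M)) hK
    simp only [subst_add hg, subst_mul hg, subst_pow hg, subst_X hg, hC, h1] at this
    exact this
  have hprod : (M - 1 - X * M * W) * (C (a * (l - 1)) - C a * (M - 1 + X * M * W)) = 0 := by
    linear_combination hquad - (X * M) * hWq
  have hMW : M - 1 - X * M * W = 0 := by
    refine (mul_eq_zero.1 hprod).resolve_right fun h => ?_
    have := congrArg (constantCoeff (R := ℂ)) h
    simp [hM, h0, ha, hl] at this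
  have hsub := mul_left_cancel₀ hg0 (b := (PowerSeries.mk fun i => r (i + 1)).subst (X * M))
    (c := W) (by linear_combination hMW - hW)
  have := congrArg (coeff k) (subst_injective_of_ne_zero hg hg0 hgc hsub)
  simpa [K] using this

theorem integral_sqrt_mul_sub {lo hi : ℝ} (h : lo < hi) :
    ∫ x in lo..hi, √((hi - x) * (x - lo)) = Real.pi / 8 * (hi - lo) ^ 2 := by
  have key := intervalIntegral.mul_integral_comp_mul_add
    (f := fun x => √((hi - x) * (x - lo))) (a := -1) (b := 1) ((hi - lo) / 2) ((hi + lo) / 2)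
  rw [show (hi - lo) / 2 * -1 + (hi + lo) / 2 = lo by ring,
    show (hi - lo) / 2 * 1 + (hi + lo) / 2 = hi by ring] at key
  rw [← key]
  have : ∀ t : ℝ, √((hi - ((hi - lo) / 2 * t + (hi + lo) / 2)) *
      ((hi - lo) / 2 * t + (hi + lo) / 2 - lo)) = (hi - lo) / 2 * √(1 - t ^ 2) := fun t => by
    rw [show (hi - ((hi - lo) / 2 * t + (hi + lo) / 2)) *
      ((hi - lo) / 2 * t + (hi + lo) / 2 - lo) = ((hi - lo) / 2) ^ 2 * (1 - t ^ 2) by ring,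
      Real.sqrt_mul (sq_nonneg _), Real.sqrt_sq (by linarith)]
  simp only [this, intervalIntegral.integral_const_mul, integral_sqrt_one_sub_sq]
  ring

theorem intervalIntegrable_inv_pow_mul_sqrt {lo hi : ℝ} (h0 : 0 < lo) (h : lo < hi) (n : ℕ) :
    IntervalIntegrable (fun x => x⁻¹ ^ n * √((hi - x) * (x - lo))) MeasureTheory.volume lo hi := by
  refine ContinuousOn.intervalIntegrable_of_Icc h.le ?_
  refine ContinuousOn.mul (ContinuousOn.pow (continuousOn_inv₀.mono fun x hx => ?_) n)
    (Continuous.continuousOn (by fun_prop))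
  exact (h0.trans_le hx.1).ne'

theorem integral_inv_pow_mul_sqrt_recurrence {lo hi : ℝ} (h0 : 0 < lo) (h : lo < hi) (n : ℕ) :
    (n + 1) * (lo * hi) * (∫ x in lo..hi, x⁻¹ ^ (n + 2) * √((hi - x) * (x - lo)))
      - (2 * n - 1) * ((lo + hi) / 2) * (∫ x in lo..hi, x⁻¹ ^ (n + 1) * √((hi - x) * (x - lo)))
      + (n - 2) * (∫ x in lo..hi, x⁻¹ ^ n * √((hi - x) * (x - lo))) = 0 := by
  have hint := intervalIntegrable_inv_pow_mul_sqrt h0 h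
  have hderiv : ∀ x ∈ Set.Ioo lo hi, HasDerivAt
      (fun x => x⁻¹ ^ (n + 1) * (((hi - x) * (x - lo)) * √((hi - x) * (x - lo))))
      ((n + 1) * (lo * hi) * (x⁻¹ ^ (n + 2) * √((hi - x) * (x - lo)))
        - (2 * n - 1) * ((lo + hi) / 2) * (x⁻¹ ^ (n + 1) * √((hi - x) * (x - lo)))
        + (n - 2) * (x⁻¹ ^ n * √((hi - x) * (x - lo)))) x := by
    intro x hx
    have hx0 : x ≠ 0 := (h0.trans hx.1).ne'
    have hpos : 0 < (hi - x) * (x - lo) := mul_pos (sub_pos.2 hx.2) (sub_pos.2 hx.1)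
    have hq : HasDerivAt (fun x : ℝ => (hi - x) * (x - lo)) (-1 * (x - lo) + (hi - x) * 1) x :=
      ((hasDerivAt_id x).const_sub hi).mul ((hasDerivAt_id x).sub_const lo)
    have := ((hasDerivAt_inv hx0).pow (n + 1)).mul (hq.mul (hq.sqrt hpos.ne'))
    refine this.congr_deriv ?_
    have hs : √((hi - x) * (x - lo)) ≠ 0 := (Real.sqrt_pos.2 hpos).ne'
    have hss : √((hi - x) * (x - lo)) ^ 2 = (hi - x) * (x - lo) := Real.sq_sqrt hpos.le
    have hyx : x * x⁻¹ = 1 := mul_inv_cancel₀ hx0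
    have hdiv : (hi - x) * (x - lo) * ((-1 * (x - lo) + (hi - x) * 1) /
        (2 * √((hi - x) * (x - lo)))) =
        √((hi - x) * (x - lo)) * (-1 * (x - lo) + (hi - x) * 1) / 2 := by
      generalize √((hi - x) * (x - lo)) = S at *
      field_simp
      linear_combination -(lo + hi - 2 * x) * hss
    simp only [Pi.mul_apply, Pi.pow_apply, hdiv, Nat.add_sub_cancel, ← inv_pow]
    push_cast
    generalize √((hi - x) * (x - lo)) = S
    linear_combination (S * x⁻¹ ^ n * ((n + 1) * (x * x⁻¹ + 1) - (lo + hi) * (n + 1) * x⁻¹ - 3))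
      * hyx
  have hcont : ContinuousOn
      (fun x => x⁻¹ ^ (n + 1) * (((hi - x) * (x - lo)) * √((hi - x) * (x - lo))))
      (Set.Icc lo hi) := by
    refine ContinuousOn.mul (ContinuousOn.pow (continuousOn_inv₀.mono fun x hx => ?_) _)
      (Continuous.continuousOn (by fun_prop))
    exact (h0.trans_le hx.1).ne'
  have h1 := ((hint (n + 2)).const_mul ((n + 1) * (lo * hi)))
  have h2 := ((hint (n + 1)).const_mul ((2 * n - 1) * ((lo + hi) / 2)))
  have h3 := ((hint n).const_mul ((n : ℝ) - 2))
  have key := intervalIntegral.integral_eq_sub_of_hasDerivAt_of_le h.le hcont hderiv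
    ((h1.sub h2).add h3)
  rw [intervalIntegral.integral_add (h1.sub h2) h3, intervalIntegral.integral_sub h1 h2] at key
  simpa only [intervalIntegral.integral_const_mul, sub_self, zero_mul, mul_zero] using key

theorem freePoissonDensity_eq {l a : ℝ} (hl : 0 ≤ l) (x : ℝ) :
    freePoissonDensity l a x =
      √((a * (1 + √l) ^ 2 - x) * (x - a * (1 - √l) ^ 2)) / (2 * Real.pi * a * x) := by
  have hs : √l ^ 2 = l := Real.sq_sqrt hl
  rw [freePoissonDensity]
  congr 2
  linear_combination (2 * a ^ 2 - 2 * a * x - (4 * a ^ 2 - a ^ 2 * (√l ^ 2 + l))) * hs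

theorem integral_freePoissonMeasure {l a : ℝ} (hl : 1 < l) (ha : 0 < a) (f : ℝ → ℝ) :
    ∫ x, f x ∂freePoissonMeasure l a =
      ∫ x in (a * (1 - √l) ^ 2)..(a * (1 + √l) ^ 2), f x * freePoissonDensity l a x := by
  have hs1 : 1 < √l := Real.lt_sqrt_of_sq_lt (by linarith)
  have hlo : 0 < a * (1 - √l) ^ 2 := mul_pos ha (sq_pos_of_neg (by linarith))
  have hle : a * (1 - √l) ^ 2 ≤ a * (1 + √l) ^ 2 := by
    apply mul_le_mul_of_nonneg_left _ ha.le
    nlinarith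
  have hzero : ∀ x, x ∉ Set.Ioc (a * (1 - √l) ^ 2) (a * (1 + √l) ^ 2) →
      freePoissonDensity l a x = 0 := by
    intro x hx
    rw [freePoissonDensity_eq (by linarith), Real.sqrt_eq_zero_of_nonpos, zero_div]
    by_contra! hc
    apply hx
    rcases (mul_pos_iff.1 hc) with h | h
    · exact ⟨by linarith, by linarith⟩
    · linarith
  have hnonneg : ∀ x, 0 ≤ freePoissonDensity l a x := by
    intro x
    by_cases hx : x ∈ Set.Ioc (a * (1 - √l) ^ 2) (a * (1 + √l) ^ 2)
    · have := hlo.trans hx.1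
      rw [freePoissonDensity]
      positivity
    · rw [hzero x hx]
  have hmeas : Measurable (freePoissonDensity l a) := by
    unfold freePoissonDensity
    fun_prop
  rw [freePoissonMeasure, max_eq_left (by linarith), ENNReal.ofReal_zero, zero_smul, zero_add,
    integral_withDensity_eq_integral_toReal_smul hmeas.ennreal_ofReal
      (Filter.Eventually.of_forall fun x => ENNReal.ofReal_lt_top),
    intervalIntegral.integral_of_le hle, ← MeasureTheory.setIntegral_eq_integral_of_forall_compl_eq_zero
      (s := Set.Ioc (a * (1 - √l) ^ 2) (a * (1 + √l) ^ 2))]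
  · simp only [ENNReal.toReal_ofReal (hnonneg _), smul_eq_mul, mul_comm]
  · intro x hx
    simp [hzero x hx]

section CStar

variable {A : Type*} [CStarAlgebra A] {φ : A →ₗ[ℂ] ℂ} {X : A}

theorem IsState.cfc_nonneg (hst : IsState φ) {g : ℝ → ℝ}
    (hg : Continuous g) (h0 : ∀ x ∈ spectrum ℝ X, 0 ≤ g x) :
    ∃ r : ℝ, 0 ≤ r ∧ φ (cfc g X) = (r : ℂ) := by
  have hs : Continuous fun x => √(g x) := hg.sqrt
  obtain ⟨r, hr, h⟩ := hst.2 (cfc (fun x => √(g x)) X)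
  refine ⟨r, hr, ?_⟩
  rw [← h, (cfc_predicate (R := ℝ) (p := IsSelfAdjoint) (fun x => √(g x)) X).star_eq,
    ← cfc_mul _ _ X hs.continuousOn hs.continuousOn]
  congr 1
  exact cfc_congr fun x hx => (Real.mul_self_sqrt (h0 x hx)).symm

theorem IsState.map_cfc_eq_integral (hst : IsState φ) (hX : IsSelfAdjoint X) {lo hi : ℝ}
    (hle : lo ≤ hi) {w : ℝ → ℝ} (hw : ContinuousOn w (Set.Icc lo hi))
    (hw0 : ∀ x ∈ Set.Icc lo hi, 0 ≤ w x)
    (hmom : ∀ r : ℕ, φ (X ^ r) = ((∫ x in lo..hi, x ^ r * w x : ℝ) : ℂ))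
    {f : ℝ → ℝ} (hf : Continuous f) :
    φ (cfc f X) = ((∫ x in lo..hi, f x * w x : ℝ) : ℂ) := by
  have hint : ∀ g : ℝ → ℝ, Continuous g →
      IntervalIntegrable (fun x => g x * w x) MeasureTheory.volume lo hi := fun g hg =>
    (hg.continuousOn.mul hw).intervalIntegrable_of_Icc hle
  have hone : ∫ x in lo..hi, w x = 1 := by
    have := hmom 0
    simp only [pow_zero, hst.1, one_mul] at this
    exact_mod_cast this.symm
  have hpoly : ∀ p : Polynomial ℝ,
      φ (cfc p.eval X) = ((∫ x in lo..hi, p.eval x * w x : ℝ) : ℂ) := by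
    intro p
    rw [cfc_polynomial p X]
    induction p using Polynomial.induction_on' with
    | add p q hp hq =>
      simp only [map_add, hp, hq, Polynomial.eval_add, add_mul]
      rw [intervalIntegral.integral_add (hint _ p.continuous) (hint _ q.continuous)]
      push_cast
      rfl
    | monomial n c =>
      rw [Polynomial.aeval_monomial, ← Algebra.smul_def, ← Complex.coe_smul, map_smul, hmom]
      simp only [Polynomial.eval_monomial, mul_assoc, intervalIntegral.integral_const_mul]
      push_cast
      rfl
  obtain ⟨K, hK⟩ : ∃ K : ℝ, spectrum ℝ X ∪ Set.Icc lo hi ⊆ Set.Icc (-K) K := by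
    obtain ⟨K, hK⟩ := ((ContinuousFunctionalCalculus.isCompact_spectrum (R := ℝ) X).union
      isCompact_Icc).isBounded.subset_closedBall 0
    exact ⟨K, by simpa [Real.closedBall_eq_Icc] using hK⟩
  refine eq_of_forall_dist_le fun ε hε => ?_
  obtain ⟨p, hp⟩ := exists_polynomial_near_of_continuousOn (-K) K f hf.continuousOn (ε / 2)
    (half_pos hε)
  have hpK : ∀ x ∈ spectrum ℝ X ∪ Set.Icc lo hi, |p.eval x - f x| ≤ ε / 2 :=
    fun x hx => (hp x (hK hx)).le
  have hφε : φ (cfc (fun _ : ℝ => ε / 2) X) = ((ε / 2 : ℝ) : ℂ) := by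
    rw [cfc_const _ X, Algebra.algebraMap_eq_smul_one, ← Complex.coe_smul, map_smul, hst.1,
      smul_eq_mul, mul_one]
  have hpc := p.continuous
  obtain ⟨r₁, hr₁, h₁⟩ := hst.cfc_nonneg (X := X) (g := fun x => (f x - p.eval x) + ε / 2)
    (by fun_prop) fun x hx => by linarith [(abs_le.1 (hpK x (.inl hx))).2]
  obtain ⟨r₂, hr₂, h₂⟩ := hst.cfc_nonneg (X := X) (g := fun x => ε / 2 - (f x - p.eval x))
    (by fun_prop) fun x hx => by linarith [(abs_le.1 (hpK x (.inl hx))).1]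
  rw [cfc_add .., cfc_sub .., map_add, map_sub, hφε, hpoly] at h₁
  rw [cfc_sub .., cfc_sub .., map_sub, map_sub, hφε, hpoly] at h₂
  have hle₁ : ∫ x in lo..hi, (f x - p.eval x) * w x ≤ ε / 2 := by
    calc _ ≤ ∫ x in lo..hi, ε / 2 * w x := by
          refine intervalIntegral.integral_mono_on hle (hint _ (by fun_prop))
            (hint _ continuous_const) fun x hx => ?_
          exact mul_le_mul_of_nonneg_right
            (by linarith [(abs_le.1 (hpK x (.inr hx))).1]) (hw0 x hx)
      _ = ε / 2 := by rw [intervalIntegral.integral_const_mul, hone, mul_one]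
  have hle₂ : -(ε / 2) ≤ ∫ x in lo..hi, (f x - p.eval x) * w x := by
    calc -(ε / 2) = ∫ x in lo..hi, -(ε / 2) * w x := by
          rw [intervalIntegral.integral_const_mul, hone, mul_one]
      _ ≤ _ := by
          refine intervalIntegral.integral_mono_on hle (hint _ continuous_const)
            (hint _ (by fun_prop)) fun x hx => ?_
          exact mul_le_mul_of_nonneg_right
            (by linarith [(abs_le.1 (hpK x (.inr hx))).2]) (hw0 x hx)
  simp only [sub_mul] at hle₁ hle₂
  rw [intervalIntegral.integral_sub (hint _ hf) (hint _ hpc)] at hle₁ hle₂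
  generalize (∫ x in lo..hi, f x * w x) = I at *
  generalize (∫ x in lo..hi, p.eval x * w x) = J at *
  have hr : φ (cfc f X) = ((r₁ + J - ε / 2 : ℝ) : ℂ) := by
    push_cast at h₁ ⊢
    linear_combination h₁
  have hsum : r₁ + r₂ = ε := by
    have : ((r₁ + r₂ : ℝ) : ℂ) = (ε : ℝ) := by
      push_cast at h₁ h₂ ⊢
      linear_combination -h₁ - h₂
    exact_mod_cast this
  rw [hr, Complex.dist_of_im_eq (by simp), Complex.ofReal_re, Complex.ofReal_re, Real.dist_eq,
    abs_le]
  constructor <;> linarith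

theorem IsState.spectrum_ge (hst : IsState φ) (hfa : Faithful φ) (hX : IsSelfAdjoint X)
    {lo hi : ℝ} (hle : lo ≤ hi) {w : ℝ → ℝ} (hw : ContinuousOn w (Set.Icc lo hi))
    (hw0 : ∀ x ∈ Set.Icc lo hi, 0 ≤ w x)
    (hmom : ∀ r : ℕ, φ (X ^ r) = ((∫ x in lo..hi, x ^ r * w x : ℝ) : ℂ)) :
    ∀ x ∈ spectrum ℝ X, lo ≤ x := by
  have hc : Continuous fun x : ℝ => max 0 (lo - x) := by fun_prop
  have hzero : cfc (fun x : ℝ => max 0 (lo - x)) X = 0 := by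
    apply hfa
    rw [(cfc_predicate (R := ℝ) (p := IsSelfAdjoint) _ X).star_eq,
      ← cfc_mul _ _ X hc.continuousOn hc.continuousOn,
      hst.map_cfc_eq_integral hX hle hw hw0 hmom (f := fun x => max 0 (lo - x) * max 0 (lo - x)) (by fun_prop),
      Complex.ofReal_eq_zero,
      intervalIntegral.integral_congr (g := fun _ => 0), intervalIntegral.integral_zero]
    intro x hx
    rw [Set.uIcc_of_le hle] at hx
    simp [max_eq_left (sub_nonpos.2 hx.1)]
  intro x hx
  have hmem : max 0 (lo - x) ∈ spectrum ℝ (0 : A) := by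
    rw [← hzero, cfc_map_spectrum ..]
    exact ⟨x, hx, rfl⟩
  have : Nontrivial A := by
    by_contra h
    rw [not_nontrivial_iff_subsingleton] at h
    simp [spectrum.of_subsingleton] at hx
  rw [spectrum.zero_eq, Set.mem_singleton_iff] at hmem
  linarith [le_max_right 0 (lo - x)]

theorem IsState.inverse_moments (hst : IsState φ) (hfa : Faithful φ) (hX : IsSelfAdjoint X)
    {lo hi : ℝ} (hlo : 0 < lo) (hle : lo ≤ hi) {w : ℝ → ℝ} (hw : ContinuousOn w (Set.Icc lo hi))
    (hw0 : ∀ x ∈ Set.Icc lo hi, 0 ≤ w x)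
    (hmom : ∀ r : ℕ, φ (X ^ r) = ((∫ x in lo..hi, x ^ r * w x : ℝ) : ℂ)) :
    IsUnit X ∧ ∀ n : ℕ, φ (Ring.inverse X ^ n) = ((∫ x in lo..hi, x⁻¹ ^ n * w x : ℝ) : ℂ) := by
  have hsp := hst.spectrum_ge hfa hX hle hw hw0 hmom
  have hg : Continuous fun x : ℝ => (max x lo)⁻¹ :=
    (continuous_id.max continuous_const).inv₀ fun x => (hlo.trans_le (le_max_right _ _)).ne'
  have hcomm := cfc_commute_cfc (R := ℝ) (p := IsSelfAdjoint) (fun x : ℝ => (max x lo)⁻¹) id X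
  rw [cfc_id ℝ X] at hcomm
  have hmul : cfc (fun x : ℝ => (max x lo)⁻¹) X * X = 1 := by
    conv_lhs => rhs; rw [← cfc_id ℝ X]
    rw [← cfc_mul _ _ X hg.continuousOn continuousOn_id, ← cfc_one ℝ X]
    refine cfc_congr fun x hx => ?_
    have := hsp x hx
    simp [max_eq_left this, (hlo.trans_le this).ne']
  let u : Aˣ := ⟨X, cfc (fun x : ℝ => (max x lo)⁻¹) X, hcomm.eq ▸ hmul, hmul⟩
  refine ⟨⟨u, rfl⟩, fun n => ?_⟩
  have hinv : Ring.inverse X = cfc (fun x : ℝ => (max x lo)⁻¹) X := Ring.inverse_unit u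
  rw [hinv, ← cfc_pow _ n X hg.continuousOn,
    hst.map_cfc_eq_integral hX hle hw hw0 hmom (f := fun x => (max x lo)⁻¹ ^ n) (hg.pow n)]
  congr 1
  refine intervalIntegral.integral_congr fun x hx => ?_
  rw [Set.uIcc_of_le hle] at hx
  simp [max_eq_left hx.1]

end CStar

/-- The negative moments of the free Poisson law satisfy a three-term recurrence. -/
theorem freePoissonDensity_inv_moments {l a : ℝ} (hl : 1 < l) (ha : 0 < a) {m : ℕ → ℝ}
    (hm : ∀ n, m n = ∫ x in (a * (1 - √l) ^ 2)..(a * (1 + √l) ^ 2),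
      x⁻¹ ^ n * freePoissonDensity l a x) (h0 : m 0 = 1) :
    a * (l - 1) * m 1 = 1 ∧
      ∀ k : ℕ, (k + 2) * (a ^ 2 * (l - 1) ^ 2) * m (k + 2)
        - (2 * k + 1) * (a * (1 + l)) * m (k + 1) + (k - 1) * m k = 0 := by
  have hs : √l ^ 2 = l := Real.sq_sqrt (by linarith)
  have hs1 : 1 < √l := by nlinarith [Real.sqrt_nonneg l]
  set lo := a * (1 - √l) ^ 2 with hlo_def
  set hi := a * (1 + √l) ^ 2 with hhi_def
  have hlo : 0 < lo := mul_pos ha (sq_pos_of_neg (by linarith))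
  have hlt : lo < hi := mul_lt_mul_of_pos_left (by nlinarith) ha
  have hprod : lo * hi = a ^ 2 * (l - 1) ^ 2 := by
    rw [hlo_def, hhi_def]
    linear_combination (a ^ 2 * (√l ^ 2 + l - 2)) * hs
  have hsum : (lo + hi) / 2 = a * (1 + l) := by
    rw [hlo_def, hhi_def]
    linear_combination a * hs
  have hdiff : (hi - lo) ^ 2 = 16 * a ^ 2 * l := by
    rw [hlo_def, hhi_def]
    linear_combination (16 * a ^ 2) * hs
  have hc : (0 : ℝ) < 2 * Real.pi * a := by positivity
  have hJ : ∀ n, (∫ x in lo..hi, x⁻¹ ^ (n + 1) * √((hi - x) * (x - lo))) =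
      2 * Real.pi * a * m n := by
    intro n
    rw [hm, ← intervalIntegral.integral_const_mul]
    congr 1
    ext x
    rw [freePoissonDensity_eq (by linarith), ← hlo_def, ← hhi_def, pow_succ]
    field_simp
  have hrec := integral_inv_pow_mul_sqrt_recurrence hlo hlt
  rw [hprod, hsum] at hrec
  constructor
  · have h := hrec 0
    rw [hJ 1, hJ 0, h0] at h
    simp only [pow_zero, one_mul, integral_sqrt_mul_sub hlt, hdiff] at h
    have hne : 2 * Real.pi * a * (a * (l - 1)) ≠ 0 := by
      have := sub_pos.2 hl
      positivity
    apply mul_left_cancel₀ hne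
    push_cast at h
    linear_combination h
  · intro k
    have h := hrec (k + 1)
    rw [hJ (k + 2), hJ (k + 1), hJ k] at h
    apply mul_left_cancel₀ hc.ne'
    push_cast at h
    linear_combination h

theorem IsState.freePoisson_inverse_moments {A : Type*} [CStarAlgebra A] {φ : A →ₗ[ℂ] ℂ}
    (hst : IsState φ) (hfa : Faithful φ) {X : A} (hX : IsSelfAdjoint X) {l a : ℝ} (hl : 1 < l)
    (ha : 0 < a) (hmom : HasMoments (⇑φ) X (freePoissonMeasure l a)) :
    IsUnit X ∧ ∀ n : ℕ, φ (Ring.inverse X ^ n) =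
      ((∫ x in (a * (1 - √l) ^ 2)..(a * (1 + √l) ^ 2),
        x⁻¹ ^ n * freePoissonDensity l a x : ℝ) : ℂ) := by
  have hs1 : 1 < √l := Real.lt_sqrt_of_sq_lt (by linarith)
  have hlo : 0 < a * (1 - √l) ^ 2 := mul_pos ha (sq_pos_of_neg (by linarith))
  refine hst.inverse_moments hfa hX hlo (mul_le_mul_of_nonneg_left (by nlinarith) ha.le)
    ?_ ?_ fun r => ?_
  · unfold freePoissonDensity
    refine ContinuousOn.div (by fun_prop) (by fun_prop) fun x hx => ?_
    have := hlo.trans_le hx.1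
    positivity
  · intro x hx
    have := hlo.trans_le hx.1
    unfold freePoissonDensity
    positivity
  · rw [hmom r, integral_freePoissonMeasure hl ha]

/-- if `X` is free Poisson distributed with rate `l > 1` and jump size `a > 0`,
then `X` is invertible and `R_k(X⁻¹) = C_{k-1} / (a^k (l-1)^{2k-1})` for all `k ≥ 1`. -/
theorem freePoisson_inverse_cumulants
    {A : Type*} [NormedRing A] [StarRing A] [CStarRing A] [CompleteSpace A]
    [NormedAlgebra ℂ A] [StarModule ℂ A]
    (φ : A →ₗ[ℂ] ℂ) (R : ∀ n, (Fin n → A) → ℂ)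
    (hst : IsState φ) (hfa : Faithful φ) (htr : Tracial φ)
    (hmc : MomentCumulant (⇑φ) R)
    (X : A) (hXsa : IsSelfAdjoint X) (l a : ℝ) (hl : 1 < l) (ha : 0 < a)
    (hmom : HasMoments (⇑φ) X (freePoissonMeasure l a)) :
    IsUnit X ∧ ∀ k : ℕ, 1 ≤ k →
      R k (fun _ => Ring.inverse X) =
        (catalan (k - 1) : ℂ) / ((a : ℂ) ^ k * ((l : ℂ) - 1) ^ (2 * k - 1)) := by
  let _ : CStarAlgebra A := { }
  obtain ⟨hunit, hinv⟩ := hst.freePoisson_inverse_moments hfa hXsa hl ha hmom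
  refine ⟨hunit, fun k hk => ?_⟩
  obtain ⟨k, rfl⟩ := Nat.exists_eq_add_of_le' hk
  have h0 : ∫ x in (a * (1 - √l) ^ 2)..(a * (1 + √l) ^ 2),
      x⁻¹ ^ 0 * freePoissonDensity l a x = 1 := by
    have := hinv 0
    rw [pow_zero, hst.1] at this
    exact_mod_cast this.symm
  obtain ⟨h1, hrec⟩ := freePoissonDensity_inv_moments hl ha (fun _ => rfl) h0
  have ha' : (a : ℂ) ≠ 0 := by exact_mod_cast ha.ne'
  have hl' : (l : ℂ) - 1 ≠ 0 := by exact_mod_cast (sub_pos.2 hl).ne'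
  have hφ0 : φ (Ring.inverse X ^ 0) = 1 := by rw [pow_zero, hst.1]
  have hquad := quadratic_of_recurrence (m := fun n => φ (Ring.inverse X ^ n)) ha' hl' hφ0
    (by simp only [hinv]; exact_mod_cast h1)
    (fun k => by simp only [hinv]; exact_mod_cast hrec k)
  refine catalan_cumulants (r := fun n => R n fun _ => Ring.inverse X) ha' hl' (fun n => ?_)
    hφ0 hquad k
  have := hmc n fun _ => Ring.inverse X
  rw [tprod, List.ofFn_const, List.prod_replicate] at this
  exact this

end FreeProbLukacs
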